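/- For any integer n ≥ 2, Φ_n'(1)/Φ_n(1) = φ(n)/2, where Φ_n' is the derivative of the n-th cyclotomic polynomial (note Φ_n(1) ≠ 0 for n ≥ 2). -/

import Mathlib

open Polynomial

/-- The logarithmic derivative turns a product of polynomials into a sum. -/
theorem eval_derivative_prod_div_eval {K ι : Type*} [Field K] (s : Finset ι) (f : ι → K[X])
    (x : K) (hf : ∀ i ∈ s, (f i).eval x ≠ 0) :
    (derivative (∏ i ∈ s, f i)).eval x / (∏ i ∈ s, f i).eval x =
      ∑ i ∈ s, (derivative (f i)).eval x / (f i).eval x := by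
  classical
  induction s using Finset.induction_on with
  | empty => simp
  | insert a s ha ih =>
    have hs : ∀ i ∈ s, (f i).eval x ≠ 0 := fun i hi => hf i (Finset.mem_insert_of_mem hi)
    have ha' := hf a (Finset.mem_insert_self a s)
    have hprod : (∏ i ∈ s, f i).eval x ≠ 0 := by
      rw [eval_prod]
      exact Finset.prod_ne_zero_iff.2 hs
    rw [Finset.prod_insert ha, Finset.sum_insert ha, ← ih hs, derivative_mul, eval_add,
      eval_mul, eval_mul, eval_mul]
    field_simp

theorem eval_one_derivative_geom_sum_div (n : ℕ) (hn : 0 < n) :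
    (derivative (∑ i ∈ Finset.range n, (X : ℚ[X]) ^ i)).eval 1 /
      (∑ i ∈ Finset.range n, (X : ℚ[X]) ^ i).eval 1 = ((n : ℚ) - 1) / 2 := by
  have hn' : (n : ℚ) ≠ 0 := by positivity
  have key : (∑ i ∈ Finset.range n, (i : ℚ)) = n * (n - 1) / 2 :=
    Finset.sum_range_induction _ (fun n : ℕ => (n : ℚ) * (n - 1) / 2) (by simp) _
      (fun k _ => by push_cast; ring)
  simp only [derivative_sum, derivative_X_pow, eval_finsetSum, eval_mul, eval_pow, eval_X,
    one_pow, mul_one, eval_C, Finset.sum_const, Finset.card_range, nsmul_eq_mul, key]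
  field_simp

theorem eval_one_cyclotomic_ne_zero (n : ℕ) (hn : 2 ≤ n) : (cyclotomic n ℚ).eval 1 ≠ 0 := by
  intro h
  have hdvd : cyclotomic n ℚ ∣ ∑ i ∈ Finset.range n, (X : ℚ[X]) ^ i := by
    rw [← prod_cyclotomic_eq_geom_sum (by omega)]
    exact Finset.dvd_prod_of_mem _ (by simp; omega)
  have h0 := eval_eq_zero_of_dvd_of_eval_eq_zero hdvd h
  simp [eval_finsetSum] at h0
  omega

/-- For `n ≥ 2`, the logarithmic derivative of the `n`-th cyclotomic polynomial at `1`
satisfies `Φₙ'(1)/Φₙ(1) = φ(n)/2`. -/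
theorem stmt_7 (n : ℕ) (hn : 2 ≤ n) :
    (derivative (cyclotomic n ℚ)).eval 1 / (cyclotomic n ℚ).eval 1 = (n.totient : ℚ) / 2 := by
  induction n using Nat.strong_induction_on with
  | _ n ih =>
  have two_le : ∀ d ∈ n.divisors.erase 1, 2 ≤ d := by
    intro d hd
    have h1 := Finset.ne_of_mem_erase hd
    have h2 := Nat.pos_of_mem_divisors (Finset.mem_of_mem_erase hd)
    omega
  have hlog := eval_derivative_prod_div_eval (n.divisors.erase 1) (fun d => cyclotomic d ℚ) 1
    fun d hd => eval_one_cyclotomic_ne_zero d (two_le d hd)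
  rw [prod_cyclotomic_eq_geom_sum (by omega), eval_one_derivative_geom_sum_div n (by omega)]
    at hlog
  have htot : ∑ d ∈ n.divisors.erase 1, (d.totient : ℚ) / 2 = ((n : ℚ) - 1) / 2 := by
    have h := Finset.add_sum_erase n.divisors Nat.totient (Nat.one_mem_divisors.2 (by omega))
    rw [Nat.sum_totient, Nat.totient_one] at h
    rw [← Finset.sum_div, ← Nat.cast_sum]
    nth_rewrite 2 [← h]
    push_cast
    ring
  have hmem : n ∈ n.divisors.erase 1 := by
    simp only [Finset.mem_erase, Nat.mem_divisors_self n (by omega), and_true]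
    omega
  have hrest : ∑ d ∈ (n.divisors.erase 1).erase n,
        (derivative (cyclotomic d ℚ)).eval 1 / (cyclotomic d ℚ).eval 1 =
      ∑ d ∈ (n.divisors.erase 1).erase n, (d.totient : ℚ) / 2 := by
    refine Finset.sum_congr rfl fun d hd => ?_
    have hd' := Finset.mem_of_mem_erase hd
    have hle := Nat.divisor_le (Finset.mem_of_mem_erase hd')
    exact ih d (lt_of_le_of_ne hle (Finset.ne_of_mem_erase hd)) (two_le d hd')
  rw [← htot, ← Finset.add_sum_erase _ _ hmem, ← Finset.add_sum_erase _ _ hmem, hrest] at hlog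
  exact (add_right_cancel hlog).symm
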